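/- arXiv:0812.0022 — 2 statements merged into one kernel-verified Lean document; each statement's English description precedes it below -/
import Mathlib

section
/- Intertwining of Q-matrices in the Poisson case (core of Theorem 3.1): for every n ≥ 1 and all real q_1,…,q_{n+1} > 0, for every y ∈ W^{n+1} and every (x′,y′) ∈ W^{n,n+1}, one has Q_Y(y,y′) · m(x′,y′) = Σ_{x ∈ W^n : x ⪯ y} m(x,y) · A((x,y),(x′,y′)), i.e. Q_Y Λ = Λ A where Λ(y,(x′,y′)) = m(x′,y′)·1{y′ = y}. -/
open scoped BigOperators

noncomputable section

/-- Sum of the entries of an integer vector. -/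
def vsum {n : ℕ} (z : Fin n → ℤ) : ℤ := ∑ i, z i

/-- `Interlace x y` means `x ⪯ y`, i.e. `y_i ≤ x_i ≤ y_{i+1}` for `1 ≤ i ≤ n`. -/
def Interlace {n : ℕ} (x : Fin n → ℤ) (y : Fin (n + 1) → ℤ) : Prop :=
  ∀ i : Fin n, y i.castSucc ≤ x i ∧ x i ≤ y i.succ

/-- `p` encodes an integer Gelfand–Tsetlin pattern with rows `1, …, n`. -/
def IsGT (n : ℕ) (p : ℕ → ℕ → ℤ) : Prop :=
  (∀ k i, 1 ≤ k → k < n → i < k → p (k + 1) i ≤ p k i ∧ p k i ≤ p (k + 1) (i + 1)) ∧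
  (∀ r i, r = 0 ∨ n < r ∨ r ≤ i → p r i = 0)

/-- `|x^r|`, the sum of the entries of row `r`. -/
def rowSum (p : ℕ → ℕ → ℤ) (r : ℕ) : ℤ := ∑ i ∈ Finset.range r, p r i

/-- The geometric weight `w^q(x) = ∏_{i=1}^n q_i^{|x^i| - |x^{i-1}|}` (0-based rates). -/
def wGT (n : ℕ) (q : ℕ → ℝ) (p : ℕ → ℕ → ℤ) : ℝ :=
  ∏ k ∈ Finset.range n, q k ^ (rowSum p (k + 1) - rowSum p k)

/-- `K_n(z)`: the Gelfand–Tsetlin patterns with bottom row `z`. -/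
def GTset (n : ℕ) (z : Fin n → ℤ) : Set (ℕ → ℕ → ℤ) :=
  {p | IsGT n p ∧ ∀ i : Fin n, p n i = z i}

/-- The Schur function `S_z(q_1, …, q_n)`. -/
def Schur (n : ℕ) (q : ℕ → ℝ) (z : Fin n → ℤ) : ℝ :=
  ∑ᶠ p ∈ GTset n z, wGT n q p

/-- `m(x,y) = q_{n+1}^{|y|−|x|} S_x(q)/S_y(q̃)`. -/
def mPois (n : ℕ) (q : ℕ → ℝ) (x : Fin n → ℤ) (y : Fin (n + 1) → ℤ) : ℝ :=
  q n ^ (vsum y - vsum x) * Schur n q x / Schur (n + 1) q y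

open Classical in
/-- The `Q`-matrix `Q_Y` on `W^{n+1}`: jumps `y → y + e_i` at rate
`S_{y+e_i}(q̃)/S_y(q̃)` when `y + e_i ∈ W^{n+1}`, with diagonal `−Σ_{i=1}^{n+1} q_i`. -/
def QY (n : ℕ) (q : ℕ → ℝ) (y y' : Fin (n + 1) → ℤ) : ℝ :=
  if y' = y then -(∑ i ∈ Finset.range (n + 1), q i)
  else if (∃ j, y' = y + Pi.single j 1) ∧ Monotone y' then
    Schur (n + 1) q y' / Schur (n + 1) q y
  else 0

open Classical in
/-- The `Q`-matrix `A` on `W^{n,n+1}` describing the bottom two rows with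
blocking and pushing. -/
def Amat (n : ℕ) (q : ℕ → ℝ) (x : Fin n → ℤ) (y : Fin (n + 1) → ℤ)
    (x' : Fin n → ℤ) (y' : Fin (n + 1) → ℤ) : ℝ :=
  if x' = x ∧ y' = y then
    -((∑ i ∈ Finset.range (n + 1), q i) +
      q n * ∑ i : Fin n, (if y' i.castSucc < x' i then (1 : ℝ) else 0))
  else if (∃ i : Fin n, x' = x + Pi.single i 1 ∧ x i < y i.succ) ∧ y' = y then
    (if Monotone x' then Schur n q x' / Schur n q x else 0)
  else if ∃ i : Fin n, x' = x + Pi.single i 1 ∧ x i = y i.succ ∧ y' = y + Pi.single i.succ 1 then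
    (if Monotone x' then Schur n q x' / Schur n q x else 0)
  else if x' = x ∧ ∃ j : Fin (n + 1), y' = y + Pi.single j 1 then q n
  else 0

theorem wGT_pos (n : ℕ) (q : ℕ → ℝ) (hq : ∀ i, 0 < q i) (p : ℕ → ℕ → ℤ) : 0 < wGT n q p :=
  Finset.prod_pos fun k _ => zpow_pos (hq k) _

/-- Entries of a Gelfand–Tsetlin pattern are bounded by any bounds on its bottom row. -/
theorem IsGT.entry_mem_Icc {n : ℕ} {p : ℕ → ℕ → ℤ} (hp : IsGT n p) {a b : ℤ}
    (hb : ∀ i < n, p n i ∈ Set.Icc a b) {r i : ℕ} (hr : r ≤ n) (hi : i < r) :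
    p r i ∈ Set.Icc a b := by
  induction hr using Nat.decreasingInduction generalizing i with
  | self => exact hb i hi
  | of_succ k hk ih =>
    have h := hp.1 k i (by omega) hk hi
    exact ⟨(ih (by omega : i < k + 1)).1.trans h.1,
      h.2.trans (ih (by omega : i + 1 < k + 1)).2⟩

theorem GTset_finite (n : ℕ) (z : Fin n → ℤ) : (GTset n z).Finite := by
  set M : ℤ := ∑ i, |z i| with hM
  have hz : ∀ i, |z i| ≤ M := fun i =>
    Finset.single_le_sum (f := fun i => |z i|) (fun j _ => abs_nonneg (z j)) (Finset.mem_univ i)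
  have hM0 : 0 ≤ M := Finset.sum_nonneg fun i _ => abs_nonneg (z i)
  have hzero : ∀ p ∈ GTset n z, ∀ r i, ¬(r ≤ n ∧ i < r) → p r i = 0 := fun p hp r i h =>
    hp.1.2 r i (by omega)
  refine Set.Finite.of_finite_image
    (f := fun (p : ℕ → ℕ → ℤ) (r : Fin (n + 1)) (i : Fin n) => p r i) ?_ ?_
  · refine (Set.finite_Icc (fun _ _ => -M) (fun _ _ => M)).subset ?_
    rintro _ ⟨p, hp, rfl⟩
    have key : ∀ r i, p r i ∈ Set.Icc (-M) M := by
      intro r i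
      by_cases h : r ≤ n ∧ i < r
      · refine hp.1.entry_mem_Icc (fun i hi => ?_) h.1 h.2
        rw [hp.2 ⟨i, hi⟩]
        exact abs_le.mp (hz _)
      · rw [hzero p hp r i h]
        exact ⟨by omega, hM0⟩
    exact ⟨fun r i => (key r i).1, fun r i => (key r i).2⟩
  · intro p hp p' hp' h
    funext r i
    by_cases hri : r ≤ n ∧ i < r
    · exact congrFun (congrFun h ⟨r, by omega⟩) ⟨i, by omega⟩
    · rw [hzero p hp r i hri, hzero p' hp' r i hri]

theorem GTset_nonempty (n : ℕ) (z : Fin n → ℤ) (hz : Monotone z) : (GTset n z).Nonempty := by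
  refine ⟨fun r i => if h : r ≤ n ∧ i < r then z ⟨i, by omega⟩ else 0, ⟨?_, ?_⟩, ?_⟩
  · intro k i _ hkn hik
    simp only [dif_pos (show k + 1 ≤ n ∧ i < k + 1 by omega), dif_pos (show k ≤ n ∧ i < k by omega),
      dif_pos (show k + 1 ≤ n ∧ i + 1 < k + 1 by omega)]
    exact ⟨le_rfl, hz (Fin.mk_le_mk.mpr (Nat.le_succ i))⟩
  · intro r i h
    exact dif_neg (by omega)
  · intro i
    exact dif_pos ⟨le_rfl, i.2⟩

theorem Schur_pos (n : ℕ) (q : ℕ → ℝ) (hq : ∀ i, 0 < q i) (z : Fin n → ℤ) (hz : Monotone z) :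
    0 < Schur n q z := by
  unfold Schur
  rw [finsum_mem_eq_finite_toFinset_sum _ (GTset_finite n z)]
  exact Finset.sum_pos (fun p _ => wGT_pos n q hq p)
    ((GTset_finite n z).toFinset_nonempty.mpr (GTset_nonempty n z hz))

theorem vsum_add_single {n : ℕ} (z : Fin n → ℤ) (i : Fin n) :
    vsum (z + Pi.single i 1) = vsum z + 1 := by
  simp [vsum, Finset.sum_add_distrib]

theorem add_single_ne_self {n : ℕ} (z : Fin n → ℤ) (i : Fin n) : z + Pi.single i 1 ≠ z := by
  simp

theorem add_single_injective {n : ℕ} (z : Fin n → ℤ) :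
    Function.Injective fun i => z + Pi.single (M := fun _ => ℤ) i 1 := by
  intro i k h
  by_contra hik
  have h' := congrFun (add_left_cancel h) i
  simp [hik] at h'

theorem Interlace.monotone {n : ℕ} {x : Fin n → ℤ} {y : Fin (n + 1) → ℤ} (h : Interlace x y)
    (hy : Monotone y) : Monotone x := by
  intro i k hik
  rcases hik.eq_or_lt with rfl | hlt
  · exact le_rfl
  · exact (h i).2.trans ((hy (show i.succ ≤ k.castSucc from hlt)).trans (h k).1)

theorem setOf_interlace_finite {n : ℕ} (y : Fin (n + 1) → ℤ) :
    {x : Fin n → ℤ | Monotone x ∧ Interlace x y}.Finite :=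
  (Set.finite_Icc (fun i => y (Fin.castSucc i)) (fun i => y (Fin.succ i))).subset
    fun _ hx => ⟨fun i => (hx.2 i).1, fun i => (hx.2 i).2⟩

section Amat

variable {n : ℕ} (q : ℕ → ℝ) {x x' : Fin n → ℤ} {y y' : Fin (n + 1) → ℤ}

theorem Amat_add_single_left {i : Fin n} (hx : Monotone (x + Pi.single i 1))
    (hi : x i < y i.succ) :
    Amat n q x y (x + Pi.single i 1) y = Schur n q (x + Pi.single i 1) / Schur n q x := by
  unfold Amat
  rw [if_neg fun h => add_single_ne_self x i h.1, if_pos ⟨⟨i, rfl, hi⟩, rfl⟩, if_pos hx]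

theorem Amat_push {i : Fin n} (hx : Monotone (x + Pi.single i 1)) (hi : x i = y i.succ) :
    Amat n q x y (x + Pi.single i 1) (y + Pi.single i.succ 1) =
      Schur n q (x + Pi.single i 1) / Schur n q x := by
  unfold Amat
  rw [if_neg fun h => add_single_ne_self x i h.1, if_neg fun h => add_single_ne_self y _ h.2,
    if_pos ⟨i, rfl, hi, rfl⟩, if_pos hx]

theorem Amat_add_single_right (j : Fin (n + 1)) :
    Amat n q x y x (y + Pi.single j 1) = q n := by
  unfold Amat
  rw [if_neg fun h => add_single_ne_self y j h.2, if_neg fun h => add_single_ne_self y j h.2,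
    if_neg fun ⟨i, h, _⟩ => add_single_ne_self x i h.symm, if_pos ⟨rfl, j, rfl⟩]

theorem Amat_self :
    Amat n q x y x y = -((∑ i ∈ Finset.range (n + 1), q i) +
      q n * ∑ i : Fin n, (if y i.castSucc < x i then (1 : ℝ) else 0)) := by
  unfold Amat
  rw [if_pos ⟨rfl, rfl⟩]

theorem Amat_eq_zero_of_left (h : x' ≠ x) (h' : ∀ i, x' ≠ x + Pi.single i 1) :
    Amat n q x y x' y' = 0 := by
  unfold Amat
  rw [if_neg fun H => h H.1, if_neg fun ⟨⟨i, H, _⟩, _⟩ => h' i H,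
    if_neg fun ⟨i, H, _⟩ => h' i H, if_neg fun H => h H.1]

theorem Amat_eq_zero_of_right (h : y' ≠ y) (h' : ∀ j, y' ≠ y + Pi.single j 1) :
    Amat n q x y x' y' = 0 := by
  unfold Amat
  rw [if_neg fun H => h H.2, if_neg fun H => h H.2,
    if_neg fun ⟨i, _, _, H⟩ => h' _ H, if_neg fun ⟨_, j, H⟩ => h' j H]

theorem Amat_eq_zero_of_not_push (h : x' ≠ x) (hy : y' ≠ y)
    (h' : ∀ i : Fin n, x' = x + Pi.single i 1 → x i = y i.succ → y' ≠ y + Pi.single i.succ 1) :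
    Amat n q x y x' y' = 0 := by
  unfold Amat
  rw [if_neg fun H => h H.1, if_neg fun H => hy H.2,
    if_neg fun ⟨i, H, H1, H2⟩ => h' i H H1 H2, if_neg fun H => h H.1]

end Amat

theorem mPois_mul_ratio (n : ℕ) (q : ℕ → ℝ) (hq : ∀ i, 0 < q i) {x : Fin n → ℤ}
    (hx : Monotone x) (i : Fin n) (y : Fin (n + 1) → ℤ) :
    mPois n q x y * (Schur n q (x + Pi.single i 1) / Schur n q x) =
      q n * mPois n q (x + Pi.single i 1) y := by
  have hS := (Schur_pos n q hq x hx).ne'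
  have hpow : q n ^ (vsum y - vsum x) = q n * q n ^ (vsum y - vsum (x + Pi.single i 1)) := by
    rw [vsum_add_single, ← zpow_one_add₀ (hq n).ne']
    congr 1
    ring
  unfold mPois
  rw [hpow]
  field_simp

theorem ratio_mul_mPois (n : ℕ) (q : ℕ → ℝ) (hq : ∀ i, 0 < q i) (x : Fin n → ℤ)
    {y : Fin (n + 1) → ℤ} {j : Fin (n + 1)} (hy : Monotone (y + Pi.single j 1)) :
    Schur (n + 1) q (y + Pi.single j 1) / Schur (n + 1) q y * mPois n q x (y + Pi.single j 1) =
      q n * mPois n q x y := by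
  have hS := (Schur_pos (n + 1) q hq _ hy).ne'
  have hpow : q n ^ (vsum (y + Pi.single j 1) - vsum x) = q n * q n ^ (vsum y - vsum x) := by
    rw [vsum_add_single, ← zpow_one_add₀ (hq n).ne']
    congr 1
    ring
  unfold mPois
  rw [hpow]
  field_simp

theorem Interlace.sub_single_iff {n : ℕ} {x : Fin n → ℤ} {y : Fin (n + 1) → ℤ}
    (h : Interlace x y) (i : Fin n) :
    Interlace (x - Pi.single i 1) y ↔ y i.castSucc < x i := by
  constructor
  · intro H
    have := (H i).1
    simp at this
    omega
  · intro hi k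
    have := h k
    by_cases hk : k = i
    · subst hk
      simp
      omega
    · simpa [Pi.single_apply, hk] using this

/-- The diagonal case of the intertwining. -/
theorem finsum_mPois_mul_Amat_self (n : ℕ) (q : ℕ → ℝ) (hq : ∀ i, 0 < q i)
    {y : Fin (n + 1) → ℤ} (hy : Monotone y) {x' : Fin n → ℤ} (h : Interlace x' y) :
    ∑ᶠ x ∈ {x : Fin n → ℤ | Monotone x ∧ Interlace x y}, mPois n q x y * Amat n q x y x' y =
      -(∑ i ∈ Finset.range (n + 1), q i) * mPois n q x' y := by
  classical
  have hterm : ∀ x ∈ {x : Fin n → ℤ | Monotone x ∧ Interlace x y},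
      mPois n q x y * Amat n q x y x' y =
        (if x = x' then mPois n q x' y * Amat n q x' y x' y else 0) +
          ∑ i : Fin n, if x = x' - Pi.single i 1 then q n * mPois n q x' y else 0 := by
    rintro x ⟨hxm, hxy⟩
    by_cases hx : x = x'
    · subst hx
      have hne : ∀ i, x ≠ x - Pi.single i 1 := fun i H =>
        add_single_ne_self x i (eq_sub_iff_add_eq.mp H)
      simp [hne]
    · rw [if_neg hx, zero_add]
      by_cases hex : ∃ k, x' = x + Pi.single k 1
      · obtain ⟨k, rfl⟩ := hex
        have hlt : x k < y k.succ := by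
          have := (h k).2
          simp at this
          omega
        rw [Amat_add_single_left q (h.monotone hy) hlt, mPois_mul_ratio n q hq hxm k y,
          Finset.sum_eq_single k]
        · simp
        · intro i _ hik
          rw [if_neg]
          intro H
          exact hik (add_single_injective x (eq_sub_iff_add_eq.mp H))
        · simp
      · push Not at hex
        rw [Amat_eq_zero_of_left q (Ne.symm hx) hex, mul_zero, Finset.sum_eq_zero]
        intro i _
        rw [if_neg]
        intro H
        exact hex i (eq_sub_iff_add_eq.mp H).symm
  rw [finsum_mem_congr rfl hterm,
    finsum_mem_eq_finite_toFinset_sum _ (setOf_interlace_finite y), Finset.sum_add_distrib,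
    Finset.sum_comm]
  have hmem : ∀ i : Fin n, (Monotone (x' - Pi.single i 1) ∧ Interlace (x' - Pi.single i 1) y) ↔
      y i.castSucc < x' i := fun i =>
    ⟨fun H => (h.sub_single_iff i).mp H.2, fun H =>
      ⟨((h.sub_single_iff i).mpr H).monotone hy, (h.sub_single_iff i).mpr H⟩⟩
  simp only [Finset.sum_ite_eq', Set.Finite.mem_toFinset, Set.mem_ofPred_eq, hmem,
    if_pos (And.intro (h.monotone hy) h), Amat_self]
  have hs : (∑ i : Fin n, if y i.castSucc < x' i then q n * mPois n q x' y else 0) =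
      q n * mPois n q x' y * ∑ i : Fin n, if y i.castSucc < x' i then (1 : ℝ) else 0 := by
    rw [Finset.mul_sum]
    simp
  rw [hs]
  ring

/-- The off-diagonal case of the intertwining. -/
theorem finsum_mPois_mul_Amat_add_single (n : ℕ) (q : ℕ → ℝ) (hq : ∀ i, 0 < q i)
    {y : Fin (n + 1) → ℤ} (hy : Monotone y) {j : Fin (n + 1)} {x' : Fin n → ℤ}
    (hx' : Monotone x') (h : Interlace x' (y + Pi.single j 1)) :
    ∑ᶠ x ∈ {x : Fin n → ℤ | Monotone x ∧ Interlace x y},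
        mPois n q x y * Amat n q x y x' (y + Pi.single j 1) =
      q n * mPois n q x' y := by
  classical
  rw [finsum_mem_eq_finite_toFinset_sum _ (setOf_interlace_finite y)]
  by_cases hin : Interlace x' y
  · rw [Finset.sum_eq_single x', Amat_add_single_right, mul_comm]
    · intro x _ hx
      rw [Amat_eq_zero_of_not_push q (Ne.symm hx) (add_single_ne_self y j), mul_zero]
      rintro i rfl hi
      have := (hin i).2
      simp at this
      omega
    · intro H
      simp [hin, hx'] at H
  · have hle : ∀ k, y k ≤ (y + Pi.single (M := fun _ => ℤ) j 1) k := fun k => by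
      simp [Pi.single_apply]
      split_ifs <;> simp
    obtain ⟨k, hk⟩ : ∃ k : Fin n, y k.succ < x' k := by
      by_contra! H
      exact hin fun i => ⟨(hle _).trans (h i).1, H i⟩
    have hkj : j = k.succ := by
      by_contra H
      have := (h k).2
      simp [Ne.symm H] at this
      omega
    subst hkj
    obtain ⟨x, rfl⟩ : ∃ x, x' = x + Pi.single k 1 := ⟨x' - Pi.single k 1, by simp⟩
    have hxk : x k = y k.succ := by
      have := (h k).2
      simp at this hk
      omega
    have hxy : Interlace x y := by
      intro i
      by_cases hik : i = k
      · subst hik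
        rw [hxk]
        exact ⟨hy (Fin.castSucc_lt_succ).le, le_rfl⟩
      · have := h i
        have h2 := hle i.castSucc
        simp [Pi.single_apply, hik] at this h2
        exact ⟨by omega, this.2⟩
    have hxm := hxy.monotone hy
    rw [Finset.sum_eq_single x, Amat_push q hx' hxk, mPois_mul_ratio n q hq hxm k y]
    · intro z hz hzx
      have hz : Monotone z ∧ Interlace z y := by simpa using hz
      rw [Amat_eq_zero_of_not_push q (fun H => hin (by rw [H]; exact hz.2)) (add_single_ne_self y _), mul_zero]
      intro i hi _ H
      have hik : k = i := Fin.succ_injective n (add_single_injective y H)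
      subst hik
      exact hzx (add_right_cancel hi).symm
    · intro H
      simp [hxm, hxy] at H

/-- Intertwining of `Q`-matrices in the Poisson case: `Q_Y Λ = Λ A`, i.e.
`Q_Y(y,y′)·m(x′,y′) = Σ_{x ⪯ y} m(x,y)·A((x,y),(x′,y′))`. -/
theorem poisson_Qmatrix_intertwining (n : ℕ) (hn : 1 ≤ n) (q : ℕ → ℝ) (hq : ∀ i, 0 < q i)
    (y : Fin (n + 1) → ℤ) (hy : Monotone y)
    (x' : Fin n → ℤ) (y' : Fin (n + 1) → ℤ)
    (hx' : Monotone x') (hy' : Monotone y') (hxy' : Interlace x' y') :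
    QY n q y y' * mPois n q x' y' =
      ∑ᶠ x ∈ {x : Fin n → ℤ | Monotone x ∧ Interlace x y},
        mPois n q x y * Amat n q x y x' y' := by
  by_cases hyy : y' = y
  · subst hyy
    rw [finsum_mPois_mul_Amat_self n q hq hy hxy', QY, if_pos rfl]
  by_cases hj : ∃ j, y' = y + Pi.single j 1
  · obtain ⟨j, rfl⟩ := hj
    rw [finsum_mPois_mul_Amat_add_single n q hq hy hx' hxy', QY, if_neg hyy,
      if_pos ⟨⟨j, rfl⟩, hy'⟩, ratio_mul_mPois n q hq x' hy']
  · rw [QY, if_neg hyy, if_neg fun H => hj H.1, zero_mul]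
    push Not at hj
    simp [Amat_eq_zero_of_right q hyy hj]
end
end

section
/- Integrating-out lemma (Lemma 4.1): let q be a real number with q > 0 and q ≠ 1, and define b(u,v) = (1−q)·1{v < u} + 1{u = v} and c(u,v) = q^{−v}·1{u ≤ v} + q^{−u}·1{u > v} for integers u,v. Then for all integers v′_1, v_2, u′ with v′_1 ≤ v_2 and v′_1 ≤ u′, one has Σ_{u = v′_1}^{min(v_2, u′)} q^{−u} · b(u, v′_1) · c(u′, v_2) = q^{−u′ − v_2}. -/
open scoped BigOperators

noncomputable section

/-- The "blocking" factor `b(u,v) = (1−q)·1{v < u} + 1{u = v}`. -/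
def bfactor (q : ℝ) (u v : ℤ) : ℝ :=
  (1 - q) * (if v < u then 1 else 0) + (if u = v then 1 else 0)

/-- The "pushing" factor `c(u,v) = q^{−v}·1{u ≤ v} + q^{−u}·1{u > v}`. -/
def cfactor (q : ℝ) (u v : ℤ) : ℝ :=
  q ^ (-v) * (if u ≤ v then 1 else 0) + q ^ (-u) * (if v < u then 1 else 0)

/-- The sum of `q^{−u} b(u,v)` over `v ≤ u ≤ m` telescopes to `q^{−m}`. -/
theorem sum_Icc_zpow_neg_mul_bfactor {q : ℝ} (hq : q ≠ 0) {v m : ℤ} (h : v ≤ m) :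
    ∑ u ∈ Finset.Icc v m, q ^ (-u) * bfactor q u v = q ^ (-m) := by
  induction m, h using Int.leInduction with
  | base => simp [bfactor]
  | succ m hm ih =>
    have hlt : v < m + 1 := by lia
    have hIcc : Finset.Icc v (m + 1) = insert (m + 1) (Finset.Icc v m) := by
      ext x
      simp only [Finset.mem_Icc, Finset.mem_insert]
      lia
    have hstep : q ^ (-m) = q ^ (-(m + 1)) * q := by
      rw [← zpow_add_one₀ hq]
      congr 1
      ring
    rw [hIcc, Finset.sum_insert (by simp), ih, hstep]
    simp only [bfactor, hlt, hlt.ne', if_true, if_false]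
    ring

theorem cfactor_eq_zpow_neg_max (q : ℝ) (u v : ℤ) : cfactor q u v = q ^ (-max v u) := by
  rcases le_or_gt u v with h | h
  · simp [cfactor, h, h.not_gt]
  · simp [cfactor, h, h.not_ge, h.le]

/-- Integrating-out lemma (Lemma 4.1): for `v′₁ ≤ v₂`, `v′₁ ≤ u′` and `0 < q ≠ 1`,
`Σ_{u = v′₁}^{min(v₂,u′)} q^{−u} b(u,v′₁) c(u′,v₂) = q^{−u′−v₂}`. -/
theorem integrating_out (q : ℝ) (hq : 0 < q) (hq1 : q ≠ 1)
    (v₁' v₂ u' : ℤ) (h1 : v₁' ≤ v₂) (h2 : v₁' ≤ u') :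
    ∑ u ∈ Finset.Icc v₁' (min v₂ u'), q ^ (-u) * bfactor q u v₁' * cfactor q u' v₂ =
      q ^ (-u' - v₂) := by
  rw [← Finset.sum_mul, sum_Icc_zpow_neg_mul_bfactor hq.ne' (le_min h1 h2),
    cfactor_eq_zpow_neg_max, ← zpow_add₀ hq.ne']
  congr 1
  lia

end
end
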